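/- The intersection of the Markov spectrum M with the open interval ((14775−599√30)/3570, (9537392579+1230099√30)/2959418678) consists of exactly one point, namely 2√65/5, which is therefore an isolated point of M. Moreover, both endpoints (14775−599√30)/3570 and (9537392579+1230099√30)/2959418678 belong to M. -/

import Mathlib

open Filter Set MeasureTheory
open scoped ENNReal

/-- Finite continued fraction `[a 0; a 1, ..., a n]`. -/
noncomputable def cfConv : (ℕ → ℝ) → ℕ → ℝ
  | a, 0 => a 0
  | a, n + 1 => a 0 + 1 / cfConv (fun i => a (i + 1)) n

/-- Value of the infinite continued fraction `[a 0; a 1, a 2, ...]`,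
as the limit of its convergents. -/
noncomputable def cfVal (a : ℕ → ℝ) : ℝ := limUnder atTop (cfConv a)

/-- `λ_k(α) = [α_k; α_{k+1}, ...] + [0; α_{k-1}, α_{k-2}, ...]`. -/
noncomputable def lambdaVal (α : ℤ → ℕ) (k : ℤ) : ℝ :=
  cfVal (fun n => (α (k + n) : ℝ)) +
  cfVal (fun n => if n = 0 then 0 else (α (k - n) : ℝ))

/-- The Markov value `m(α) = sup_{k ∈ ℤ} λ_k(α)`. -/
noncomputable def markovValue (α : ℤ → ℕ) : ℝ := ⨆ k : ℤ, lambdaVal α k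

/-- The Markov spectrum. -/
def markovSpectrum : Set ℝ :=
  { x | ∃ α : ℤ → ℕ, (∀ n, 0 < α n) ∧ BddAbove (range (lambdaVal α)) ∧
      markovValue α = x }

/-- The dimension function `d(t) = dim_H (M ∩ (-∞, t))`. -/
noncomputable def dimFun (t : ℝ) : ℝ≥0∞ := dimH (markovSpectrum ∩ Iio t)

section Convergents

lemma one_le_cfConv (a : ℕ → ℝ) (ha : ∀ n, 1 ≤ a n) (n : ℕ) : 1 ≤ cfConv a n := by
  induction n generalizing a with
  | zero => exact ha 0
  | succ n ih =>
    have h := ih (fun i => a (i + 1)) fun i => ha _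
    have : 0 < 1 / cfConv (fun i => a (i + 1)) n := by positivity
    rw [cfConv]
    linarith [ha 0]

lemma abs_inv_sub_inv_le {x y : ℝ} (hx : 1 ≤ x) (hy : 1 ≤ y) : |1 / x - 1 / y| ≤ 1 := by
  have h1 : 1 / x ≤ 1 := by rw [div_le_one (by linarith)]; exact hx
  have h2 : 1 / y ≤ 1 := by rw [div_le_one (by linarith)]; exact hy
  have h3 : 0 < 1 / x := by positivity
  have h4 : 0 < 1 / y := by positivity
  rw [abs_le]
  constructor <;> linarith

lemma abs_double_step_le {a b x y : ℝ} (hb : 1 ≤ b) (hx : 1 ≤ x) (hy : 1 ≤ y) :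
    |(a + 1 / (b + 1 / x)) - (a + 1 / (b + 1 / y))| ≤ 1 / 4 * |x - y| := by
  have hx' : 2 ≤ b * x + 1 := by nlinarith
  have hy' : 2 ≤ b * y + 1 := by nlinarith
  have key : (a + 1 / (b + 1 / x)) - (a + 1 / (b + 1 / y))
      = (x - y) / ((b * x + 1) * (b * y + 1)) := by
    field_simp
    ring
  rw [key, abs_div, abs_of_pos (show 0 < (b * x + 1) * (b * y + 1) by positivity),
    div_le_iff₀ (by positivity)]
  nlinarith [abs_nonneg (x - y), mul_le_mul hx' hy' (by norm_num) (by linarith)]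

lemma abs_cfConv_sub_le (N : ℕ) (a : ℕ → ℝ) (ha : ∀ n, 1 ≤ a n) (m n : ℕ) :
    |cfConv a (m + 1 + 2 * N) - cfConv a (n + 1 + 2 * N)| ≤ (1 / 4) ^ N := by
  induction N generalizing a with
  | zero =>
    have hm := one_le_cfConv (fun i => a (i + 1)) (fun i => ha _) m
    have hn := one_le_cfConv (fun i => a (i + 1)) (fun i => ha _) n
    simpa [cfConv] using abs_inv_sub_inv_le hm hn
  | succ N ih =>
    have hb : ∀ i, 1 ≤ (fun i => a (i + 1 + 1)) i := fun i => ha _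
    have h := abs_double_step_le (a := a 0) (ha 1) (one_le_cfConv _ hb (m + 1 + 2 * N))
      (one_le_cfConv _ hb (n + 1 + 2 * N))
    have e : ∀ j, cfConv a (j + 1 + 2 * (N + 1))
        = a 0 + 1 / (a 1 + 1 / cfConv (fun i => a (i + 1 + 1)) (j + 1 + 2 * N)) := by
      intro j
      rw [show j + 1 + 2 * (N + 1) = (j + 1 + 2 * N) + 1 + 1 by ring, cfConv, cfConv]
    rw [e, e]
    refine h.trans ?_
    rw [pow_succ']
    exact mul_le_mul_of_nonneg_left (ih _ hb) (by norm_num)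

lemma tendsto_cfConv (a : ℕ → ℝ) (ha : ∀ n, 1 ≤ a n) :
    Tendsto (cfConv a) atTop (nhds (cfVal a)) := by
  have hc : CauchySeq (cfConv a) := by
    rw [Metric.cauchySeq_iff]
    intro ε hε
    obtain ⟨N, hN⟩ := exists_pow_lt_of_lt_one hε (show (1 / 4 : ℝ) < 1 by norm_num)
    refine ⟨1 + 2 * N, fun m hm n hn => ?_⟩
    obtain ⟨i, rfl⟩ := Nat.exists_eq_add_of_le hm
    obtain ⟨j, rfl⟩ := Nat.exists_eq_add_of_le hn
    have h := abs_cfConv_sub_le N a ha i j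
    rw [Real.dist_eq, show 1 + 2 * N + i = i + 1 + 2 * N by ring,
      show 1 + 2 * N + j = j + 1 + 2 * N by ring]
    exact h.trans_lt hN
  exact CauchySeq.tendsto_limUnder hc

lemma one_le_cfVal (a : ℕ → ℝ) (ha : ∀ n, 1 ≤ a n) : 1 ≤ cfVal a :=
  ge_of_tendsto' (tendsto_cfConv a ha) (one_le_cfConv a ha)

lemma cfVal_eq (a : ℕ → ℝ) (ha : ∀ n, 1 ≤ a (n + 1)) :
    cfVal a = a 0 + 1 / cfVal (fun i => a (i + 1)) := by
  have h1 := tendsto_cfConv (fun i => a (i + 1)) ha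
  have h2 := one_le_cfVal (fun i => a (i + 1)) ha
  have h3 : Tendsto (fun n => cfConv a (n + 1)) atTop
      (nhds (a 0 + 1 / cfVal (fun i => a (i + 1)))) := by
    simp only [cfConv]
    exact tendsto_const_nhds.add (tendsto_const_nhds.div h1 (by linarith))
  exact ((tendsto_add_atTop_iff_nat 1).1 h3).limUnder_eq

end Convergents

/-- The reflected sequence. -/
def reflect (α : ℤ → ℕ) (n : ℤ) : ℕ := α (-n)

/-- The right tail `[0; α_{k+1}, α_{k+2}, ...]`. -/
noncomputable def rightTail (α : ℤ → ℕ) (k : ℤ) : ℝ :=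
  1 / cfVal (fun n : ℕ => (α (k + 1 + n) : ℝ))

/-- The left tail `[0; α_{k-1}, α_{k-2}, ...]`. -/
noncomputable def leftTail (α : ℤ → ℕ) (k : ℤ) : ℝ := rightTail (reflect α) (-k)

section Tails

variable {α : ℤ → ℕ}

lemma reflect_pos (h : ∀ n, 0 < α n) (n : ℤ) : 0 < reflect α n := h _

lemma reflect_reflect (α : ℤ → ℕ) : reflect (reflect α) = α := by
  funext n
  simp [reflect]

lemma one_le_cast_of_pos (h : ∀ n, 0 < α n) (n : ℤ) : (1 : ℝ) ≤ α n := by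
  exact_mod_cast h n

lemma rightTail_pos (h : ∀ n, 0 < α n) (k : ℤ) : 0 < rightTail α k := by
  have := one_le_cfVal (fun n : ℕ => (α (k + 1 + n) : ℝ)) fun n => one_le_cast_of_pos h _
  unfold rightTail
  positivity

lemma rightTail_le_one (h : ∀ n, 0 < α n) (k : ℤ) : rightTail α k ≤ 1 := by
  have := one_le_cfVal (fun n : ℕ => (α (k + 1 + n) : ℝ)) fun n => one_le_cast_of_pos h _
  unfold rightTail
  rw [div_le_one (by linarith)]
  exact this

lemma cfVal_shift (h : ∀ n, 0 < α n) (k : ℤ) :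
    cfVal (fun n : ℕ => (α (k + n) : ℝ)) = α k + rightTail α k := by
  rw [cfVal_eq _ fun n => one_le_cast_of_pos h _, rightTail]
  simp only [Nat.cast_add, Nat.cast_one, Nat.cast_zero, add_zero]
  congr 4
  funext n
  rw [show k + ((n : ℤ) + 1) = k + 1 + n by ring]

lemma rightTail_eq (h : ∀ n, 0 < α n) {k j : ℤ} (hj : j = k + 1) :
    rightTail α k = 1 / (α j + rightTail α j) := by
  subst hj
  rw [← cfVal_shift h, rightTail]

lemma leftTail_eq (h : ∀ n, 0 < α n) {k j : ℤ} (hj : j = k - 1) :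
    leftTail α k = 1 / (α j + leftTail α j) := by
  rw [leftTail, rightTail_eq (reflect_pos h) (show -j = -k + 1 by omega)]
  simp [reflect, leftTail]

lemma lambdaVal_eq (h : ∀ n, 0 < α n) (k : ℤ) :
    lambdaVal α k = α k + rightTail α k + leftTail α k := by
  rw [lambdaVal, cfVal_shift h]
  congr 1
  rw [cfVal_eq _ fun n => by simpa using one_le_cast_of_pos h _, leftTail, rightTail]
  simp only [reflect, if_true, zero_add, Nat.add_eq_zero_iff, one_ne_zero, and_false, if_false]
  congr 2
  funext n
  congr 2
  push_cast
  ring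

lemma leftTail_reflect (α : ℤ → ℕ) (k : ℤ) : leftTail (reflect α) k = rightTail α (-k) := by
  rw [leftTail, reflect_reflect]

lemma lambdaVal_reflect (h : ∀ n, 0 < α n) (k : ℤ) :
    lambdaVal (reflect α) k = lambdaVal α (-k) := by
  rw [lambdaVal_eq h, lambdaVal_eq (reflect_pos h), leftTail_reflect, leftTail, neg_neg, reflect]
  ring

lemma rightTail_periodic {k p : ℤ} (hp : ∀ n, k < n → α (n + p) = α n) :
    rightTail α (k + p) = rightTail α k := by
  unfold rightTail
  congr 3
  funext n
  rw [← hp (k + 1 + n) (by omega)]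
  congr 2
  ring

end Tails

section Words

variable {α : ℤ → ℕ}

lemma reflect_neg_add (α : ℤ → ℕ) (k i : ℤ) : reflect α (-k + i) = α (k - i) := by
  unfold reflect
  congr 1
  ring

lemma reflect_neg_sub (α : ℤ → ℕ) (k i : ℤ) : reflect α (-k - i) = α (k + i) := by
  unfold reflect
  congr 1
  ring

lemma reflect_neg (α : ℤ → ℕ) (k : ℤ) : reflect α (-k) = α k := by
  simp [reflect]

lemma rightTail_reflect_neg (α : ℤ → ℕ) (k : ℤ) :
    rightTail (reflect α) (-k) = leftTail α k := rfl

lemma rightTail_reflect_neg_add (α : ℤ → ℕ) (k i : ℤ) :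
    rightTail (reflect α) (-k + i) = leftTail α (k - i) := by
  unfold leftTail
  congr 1
  ring

/-- All entries are `1` or `2`. -/
def IsBinary (α : ℤ → ℕ) : Prop := ∀ n, α n = 1 ∨ α n = 2

namespace IsBinary

lemma pos (hb : IsBinary α) (n : ℤ) : 0 < α n := by
  rcases hb n with h | h <;> omega

lemma reflect (hb : IsBinary α) : IsBinary (reflect α) := fun _ => hb _

lemma eq_one (hb : IsBinary α) {n : ℤ} (h : α n ≠ 2) : α n = 1 := (hb n).resolve_right h

lemma eq_two (hb : IsBinary α) {n : ℤ} (h : α n ≠ 1) : α n = 2 := (hb n).resolve_left h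

/-- Bounds on a tail propagate one step outwards. -/
lemma rightTail_bounds_step (hb : IsBinary α) {l u : ℝ} (hl : 0 < l)
    (h : ∀ k, l ≤ rightTail α k ∧ rightTail α k ≤ u) (k : ℤ) :
    1 / (2 + u) ≤ rightTail α k ∧ rightTail α k ≤ 1 / (1 + l) := by
  rw [rightTail_eq hb.pos (k := k) rfl]
  obtain ⟨h1, h2⟩ := h (k + 1)
  constructor
  · apply one_div_le_one_div_of_le
    · rcases hb (k + 1) with h | h <;> rw [h] <;> push_cast <;> linarith
    · rcases hb (k + 1) with h | h <;> rw [h] <;> push_cast <;> linarith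
  · apply one_div_le_one_div_of_le (by linarith)
    rcases hb (k + 1) with h | h <;> rw [h] <;> push_cast <;> linarith

lemma rightTail_bounds (hb : IsBinary α) (k : ℤ) :
    56 / 153 ≤ rightTail α k ∧ rightTail α k ≤ 41 / 56 := by
  have h0 : ∀ k, 1 / 3 ≤ rightTail α k ∧ rightTail α k ≤ 1 := by
    intro k
    refine ⟨?_, rightTail_le_one hb.pos k⟩
    have h1 := rightTail_le_one hb.pos (k + 1)
    have h2 := rightTail_pos hb.pos (k + 1)
    rw [rightTail_eq hb.pos (k := k) rfl]
    apply one_div_le_one_div_of_le <;>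
    rcases hb (k + 1) with h | h <;> rw [h] <;> push_cast <;> linarith
  have h1 := hb.rightTail_bounds_step (by norm_num) h0
  have h2 := hb.rightTail_bounds_step (by norm_num) h1
  have h3 := hb.rightTail_bounds_step (by norm_num) h2
  have h4 := hb.rightTail_bounds_step (by norm_num) h3
  have h5 := hb.rightTail_bounds_step (by norm_num) h4
  have h6 := hb.rightTail_bounds_step (by norm_num) h5
  obtain ⟨hl, hu⟩ := h6 k
  exact ⟨le_trans (by norm_num) hl, le_trans hu (by norm_num)⟩

lemma leftTail_bounds (hb : IsBinary α) (k : ℤ) :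
    56 / 153 ≤ leftTail α k ∧ leftTail α k ≤ 41 / 56 := hb.reflect.rightTail_bounds _

/-! Tails with a prescribed initial word, as Möbius functions of the remaining tail. -/

lemma rightTail_1 (hb : IsBinary α) {k : ℤ} (h1 : α (k + 1) = 1) :
    rightTail α k = 1 / (1 + rightTail α (k + 1)) := by
  rw [rightTail_eq hb.pos (k := k) rfl, h1, Nat.cast_one]

lemma rightTail_2 (hb : IsBinary α) {k : ℤ} (h1 : α (k + 1) = 2) :
    rightTail α k = 1 / (2 + rightTail α (k + 1)) := by
  rw [rightTail_eq hb.pos (k := k) rfl, h1, Nat.cast_two]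

lemma rightTail_11 (hb : IsBinary α) {k : ℤ} (h1 : α (k + 1) = 1) (h2 : α (k + 2) = 1) :
    rightTail α k = (rightTail α (k + 2) + 1) / (rightTail α (k + 2) + 2) := by
  have := rightTail_pos hb.pos (k + 2)
  rw [hb.rightTail_1 h1, rightTail_eq hb.pos (show k + 2 = k + 1 + 1 by ring), h2]
  push_cast
  field_simp
  ring

lemma rightTail_12 (hb : IsBinary α) {k : ℤ} (h1 : α (k + 1) = 1) (h2 : α (k + 2) = 2) :
    rightTail α k = (rightTail α (k + 2) + 2) / (rightTail α (k + 2) + 3) := by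
  have := rightTail_pos hb.pos (k + 2)
  rw [hb.rightTail_1 h1, rightTail_eq hb.pos (show k + 2 = k + 1 + 1 by ring), h2]
  push_cast
  field_simp
  ring

lemma rightTail_112 (hb : IsBinary α) {k : ℤ} (h1 : α (k + 1) = 1) (h2 : α (k + 2) = 1)
    (h3 : α (k + 3) = 2) :
    rightTail α k = (rightTail α (k + 3) + 3) / (2 * rightTail α (k + 3) + 5) := by
  have := rightTail_pos hb.pos (k + 3)
  rw [hb.rightTail_11 h1 h2, rightTail_eq hb.pos (show k + 3 = k + 2 + 1 by ring), h3]
  push_cast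
  field_simp
  ring

lemma rightTail_111 (hb : IsBinary α) {k : ℤ} (h1 : α (k + 1) = 1) (h2 : α (k + 2) = 1)
    (h3 : α (k + 3) = 1) :
    rightTail α k = (rightTail α (k + 3) + 2) / (2 * rightTail α (k + 3) + 3) := by
  have := rightTail_pos hb.pos (k + 3)
  rw [hb.rightTail_11 h1 h2, rightTail_eq hb.pos (show k + 3 = k + 2 + 1 by ring), h3]
  push_cast
  field_simp
  ring

lemma rightTail_1112 (hb : IsBinary α) {k : ℤ} (h1 : α (k + 1) = 1) (h2 : α (k + 2) = 1)
    (h3 : α (k + 3) = 1) (h4 : α (k + 4) = 2) :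
    rightTail α k = (2 * rightTail α (k + 4) + 5) / (3 * rightTail α (k + 4) + 8) := by
  have := rightTail_pos hb.pos (k + 4)
  rw [hb.rightTail_111 h1 h2 h3, rightTail_eq hb.pos (show k + 4 = k + 3 + 1 by ring), h4]
  push_cast
  field_simp
  ring

lemma rightTail_1111 (hb : IsBinary α) {k : ℤ} (h1 : α (k + 1) = 1) (h2 : α (k + 2) = 1)
    (h3 : α (k + 3) = 1) (h4 : α (k + 4) = 1) :
    rightTail α k = (2 * rightTail α (k + 4) + 3) / (3 * rightTail α (k + 4) + 5) := by
  have := rightTail_pos hb.pos (k + 4)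
  rw [hb.rightTail_111 h1 h2 h3, rightTail_eq hb.pos (show k + 4 = k + 3 + 1 by ring), h4]
  push_cast
  field_simp
  ring

lemma rightTail_11111 (hb : IsBinary α) {k : ℤ} (h1 : α (k + 1) = 1) (h2 : α (k + 2) = 1)
    (h3 : α (k + 3) = 1) (h4 : α (k + 4) = 1) (h5 : α (k + 5) = 1) :
    rightTail α k = (3 * rightTail α (k + 5) + 5) / (5 * rightTail α (k + 5) + 8) := by
  have := rightTail_pos hb.pos (k + 5)
  rw [hb.rightTail_1111 h1 h2 h3 h4, rightTail_eq hb.pos (show k + 5 = k + 4 + 1 by ring), h5]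
  push_cast
  field_simp
  ring

lemma rightTail_11112 (hb : IsBinary α) {k : ℤ} (h1 : α (k + 1) = 1) (h2 : α (k + 2) = 1)
    (h3 : α (k + 3) = 1) (h4 : α (k + 4) = 1) (h5 : α (k + 5) = 2) :
    rightTail α k = (3 * rightTail α (k + 5) + 8) / (5 * rightTail α (k + 5) + 13) := by
  have := rightTail_pos hb.pos (k + 5)
  rw [hb.rightTail_1111 h1 h2 h3 h4, rightTail_eq hb.pos (show k + 5 = k + 4 + 1 by ring), h5]
  push_cast
  field_simp
  ring

lemma rightTail_11112112 (hb : IsBinary α) {k : ℤ} (h1 : α (k + 1) = 1) (h2 : α (k + 2) = 1)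
    (h3 : α (k + 3) = 1) (h4 : α (k + 4) = 1) (h5 : α (k + 5) = 2) (h6 : α (k + 6) = 1)
    (h7 : α (k + 7) = 1) (h8 : α (k + 8) = 2) :
    rightTail α k = (19 * rightTail α (k + 8) + 49) / (31 * rightTail α (k + 8) + 80) := by
  have := rightTail_pos hb.pos (k + 8)
  have e := hb.rightTail_112 (k := k + 5) (by rwa [add_assoc]) (by rwa [add_assoc])
    (by rwa [add_assoc])
  rw [add_assoc] at e
  norm_num at e
  rw [hb.rightTail_11112 h1 h2 h3 h4 h5, e]
  field_simp
  ring

end IsBinary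

end Words

section Admissible

variable {α : ℤ → ℕ}

/-- Binary sequences that avoid the words `2121`, `21112111` and their reversals. -/
structure Admissible (α : ℤ → ℕ) : Prop where
  binary : IsBinary α
  right_two (k : ℤ) : α k = 2 → α (k + 1) = 1 → α (k + 2) = 2 → α (k + 3) = 2
  left_two (k : ℤ) : α k = 2 → α (k - 1) = 1 → α (k - 2) = 2 → α (k - 3) = 2
  right_one (k : ℤ) : α k = 2 → α (k + 1) = 1 → α (k + 2) = 1 → α (k + 3) = 1 →
    α (k - 1) = 1 → α (k - 2) = 1 → α (k - 3) = 1 → α (k + 4) = 1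
  left_one (k : ℤ) : α k = 2 → α (k + 1) = 1 → α (k + 2) = 1 → α (k + 3) = 1 →
    α (k - 1) = 1 → α (k - 2) = 1 → α (k - 3) = 1 → α (k - 4) = 1

lemma Admissible.reflect (h : Admissible α) : Admissible (reflect α) where
  binary := h.binary.reflect
  right_two k := by simpa only [_root_.reflect, neg_add'] using h.left_two (-k)
  left_two k := by simpa only [_root_.reflect, neg_sub', sub_neg_eq_add] using h.right_two (-k)
  right_one k h0 h1 h2 h3 h4 h5 h6 := by
    simp only [_root_.reflect, neg_add', neg_sub', sub_neg_eq_add] at *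
    exact h.left_one (-k) h0 h4 h5 h6 h1 h2 h3
  left_one k h0 h1 h2 h3 h4 h5 h6 := by
    simp only [_root_.reflect, neg_add', neg_sub', sub_neg_eq_add] at *
    exact h.right_one (-k) h0 h4 h5 h6 h1 h2 h3

/-- The value `[0; 1, 2, 2, 2, 1, 2, 2, 2, ...]`. -/
noncomputable def tailMax : ℝ := (-6 + 2 * Real.sqrt 30) / 7

lemma sqrt_thirty_bounds : 5.4772255 < Real.sqrt 30 ∧ Real.sqrt 30 < 5.4772256 :=
  ⟨Real.lt_sqrt_of_sq_lt (by norm_num), (Real.sqrt_lt' (by norm_num)).2 (by norm_num)⟩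

lemma tailMax_bounds : 0.70777871 < tailMax ∧ tailMax < 0.70777875 := by
  obtain ⟨h1, h2⟩ := sqrt_thirty_bounds
  unfold tailMax
  constructor <;> linarith

lemma tailMax_quadratic : 7 * tailMax ^ 2 + 12 * tailMax = 12 := by
  have h : Real.sqrt 30 ^ 2 = 30 := Real.sq_sqrt (by norm_num)
  unfold tailMax
  linear_combination (4 / 7) * h

lemma rightTail_1222 (hb : IsBinary α) {k : ℤ} (h1 : α (k + 1) = 1) (h2 : α (k + 2) = 2)
    (h3 : α (k + 3) = 2) (h4 : α (k + 4) = 2) :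
    rightTail α k = (5 * rightTail α (k + 4) + 12) / (7 * rightTail α (k + 4) + 17) := by
  have := rightTail_pos hb.pos (k + 4)
  rw [hb.rightTail_12 h1 h2, rightTail_eq hb.pos (show k + 3 = k + 2 + 1 by ring), h3,
    rightTail_eq hb.pos (show k + 4 = k + 3 + 1 by ring), h4]
  push_cast
  field_simp
  ring

lemma Admissible.rightTail_le_tailMax_add (h : Admissible α) (n : ℕ) {k : ℤ} (hk : α k = 2) :
    rightTail α k ≤ tailMax + (1 / 2) ^ n := by
  obtain ⟨m1, m2⟩ := tailMax_bounds
  have hb := h.binary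
  induction n generalizing k with
  | zero => linarith [rightTail_le_one hb.pos k]
  | succ n ih =>
    have hp : (0 : ℝ) < (1 / 2) ^ (n + 1) := by positivity
    rcases hb (k + 1) with h1 | h1
    swap
    · have := rightTail_pos hb.pos (k + 1)
      have : rightTail α k ≤ 1 / 2 := by
        rw [hb.rightTail_2 h1]
        exact one_div_le_one_div_of_le (by norm_num) (by linarith)
      linarith
    rcases hb (k + 2) with h2 | h2
    · have e := hb.rightTail_11 h1 h2
      have h0 := rightTail_pos hb.pos (k + 2)
      have h1 := rightTail_le_one hb.pos (k + 2)
      have : rightTail α k ≤ 2 / 3 := by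
        rw [e, div_le_div_iff₀ (by linarith) (by norm_num)]
        linarith
      linarith
    have h3 := h.right_two k hk h1 h2
    rcases hb (k + 4) with h4 | h4
    · have e := hb.rightTail_12 h1 h2
      have e3 := rightTail_eq hb.pos (show k + 3 = k + 2 + 1 by ring)
      have e4 := rightTail_eq hb.pos (show k + 4 = k + 3 + 1 by ring)
      rw [h3, Nat.cast_two] at e3
      rw [h4, Nat.cast_one] at e4
      have p4 := rightTail_pos hb.pos (k + 4)
      have l4 := rightTail_le_one hb.pos (k + 4)
      have : rightTail α k ≤ 12 / 17 := by
        have q3 : 1 / 2 ≤ rightTail α (k + 3) := by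
          rw [e4]
          exact one_div_le_one_div_of_le (by linarith) (by linarith)
        have q2 : rightTail α (k + 2) ≤ 2 / 5 := by
          rw [e3, div_le_div_iff₀ (by linarith) (by norm_num)]
          linarith
        have p2 := rightTail_pos hb.pos (k + 2)
        rw [e, div_le_div_iff₀ (by linarith) (by norm_num)]
        linarith
      linarith
    · have e := rightTail_1222 hb h1 h2 h3 h4
      have p4 := rightTail_pos hb.pos (k + 4)
      have ih4 := ih h4
      rw [e, div_le_iff₀ (by linarith), pow_succ]
      have q := tailMax_quadratic
      have hp : (0 : ℝ) < (1 / 2) ^ n := by positivity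
      nlinarith [mul_pos hp p4]

lemma Admissible.rightTail_le_tailMax (h : Admissible α) {k : ℤ} (hk : α k = 2) :
    rightTail α k ≤ tailMax := by
  have ht : Tendsto (fun n : ℕ => tailMax + (1 / 2 : ℝ) ^ n) atTop (nhds (tailMax + 0)) :=
    tendsto_const_nhds.add (tendsto_pow_atTop_nhds_zero_of_lt_one (by norm_num) (by norm_num))
  rw [add_zero] at ht
  exact ge_of_tendsto' ht fun n => h.rightTail_le_tailMax_add n hk

lemma Admissible.le_rightTail (h : Admissible α) (k : ℤ) :
    1 / (2 + tailMax) ≤ rightTail α k := by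
  obtain ⟨m1, m2⟩ := tailMax_bounds
  rcases h.binary (k + 1) with h1 | h1
  · have p := rightTail_pos h.binary.pos (k + 1)
    have l := rightTail_le_one h.binary.pos (k + 1)
    rw [h.binary.rightTail_1 h1]
    exact one_div_le_one_div_of_le (by linarith) (by linarith)
  · have p := rightTail_pos h.binary.pos (k + 1)
    have l := h.rightTail_le_tailMax h1
    rw [h.binary.rightTail_2 h1]
    exact one_div_le_one_div_of_le (by linarith) (by linarith)

lemma Admissible.le_leftTail (h : Admissible α) (k : ℤ) : 1 / (2 + tailMax) ≤ leftTail α k :=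
  h.reflect.le_rightTail _

/-- The value `[0; 1, 1, 2, 2 + tailMax]` bounds tails starting with `1, 1, 2`. -/
lemma Admissible.rightTail_112_le (h : Admissible α) {k : ℤ} (h1 : α (k + 1) = 1)
    (h2 : α (k + 2) = 1) (h3 : α (k + 3) = 2) :
    rightTail α k ≤ (3 * tailMax + 7) / (5 * tailMax + 12) := by
  obtain ⟨m1, m2⟩ := tailMax_bounds
  have low := h.le_rightTail (k + 3)
  have p := rightTail_pos h.binary.pos (k + 3)
  rw [div_le_iff₀ (by linarith)] at low
  rw [h.binary.rightTail_112 h1 h2 h3, div_le_div_iff₀ (by linarith) (by linarith)]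
  linarith

/-- The value `[0; 1, 1, 1, 2, 1, 1, 2, 2 + tailMax]` bounds tails starting with `1, 1, 1`
that follow an entry `2`. -/
lemma Admissible.rightTail_111_le (h : Admissible α) {k : ℤ} (h0 : α k = 2) (h1 : α (k + 1) = 1)
    (h2 : α (k + 2) = 1) (h3 : α (k + 3) = 1) :
    rightTail α k ≤ (31 * tailMax + 74) / (49 * tailMax + 117) := by
  obtain ⟨m1, m2⟩ := tailMax_bounds
  have hb := h.binary
  have p4 := rightTail_pos hb.pos (k + 4)
  have l4 := rightTail_le_one hb.pos (k + 4)
  rcases hb (k + 4) with h4 | h4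
  · rw [hb.rightTail_1111 h1 h2 h3 h4, div_le_div_iff₀ (by linarith) (by linarith)]
    nlinarith
  suffices q : rightTail α (k + 4) ≤ (3 * tailMax + 7) / (5 * tailMax + 12) by
    rw [le_div_iff₀ (by linarith)] at q
    rw [hb.rightTail_1112 h1 h2 h3 h4, div_le_div_iff₀ (by linarith) (by linarith)]
    linarith
  have a5 : k + 4 + 1 = k + 5 := by ring
  have a6 : k + 4 + 2 = k + 6 := by ring
  have a7 : k + 4 + 3 = k + 7 := by ring
  rcases hb (k + 5) with h5 | h5
  swap
  · have p5 := rightTail_pos hb.pos (k + 5)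
    rw [hb.rightTail_2 (by rwa [a5]), a5, div_le_div_iff₀ (by linarith) (by linarith)]
    nlinarith
  have h6 : α (k + 6) = 1 := by
    refine hb.eq_one fun h6 => ?_
    have := h.left_two (k + 6) h6 (by rwa [show k + 6 - 1 = k + 5 by ring])
      (by rwa [show k + 6 - 2 = k + 4 by ring])
    rw [show k + 6 - 3 = k + 3 by ring] at this
    omega
  have h7 : α (k + 7) = 2 := by
    refine hb.eq_two fun h7 => ?_
    have := h.left_one (k + 4) h4 (by rwa [a5]) (by rwa [a6]) (by rwa [a7])
      (by rwa [show k + 4 - 1 = k + 3 by ring]) (by rwa [show k + 4 - 2 = k + 2 by ring])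
      (by rwa [show k + 4 - 3 = k + 1 by ring])
    rw [show k + 4 - 4 = k by ring] at this
    omega
  exact h.rightTail_112_le (by rwa [a5]) (by rwa [a6]) (by rwa [a7])

lemma Admissible.leftTail_112_le (h : Admissible α) {k : ℤ} (h1 : α (k - 1) = 1)
    (h2 : α (k - 2) = 1) (h3 : α (k - 3) = 2) :
    leftTail α k ≤ (3 * tailMax + 7) / (5 * tailMax + 12) := by
  have := h.reflect.rightTail_112_le (k := -k)
  simp only [reflect_neg_add] at this
  exact this h1 h2 h3

/-- The left endpoint of the gap. -/
noncomputable def gapLeft : ℝ := (14775 - 599 * Real.sqrt 30) / 3570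

/-- The right endpoint of the gap. -/
noncomputable def gapRight : ℝ := (9537392579 + 1230099 * Real.sqrt 30) / 2959418678

lemma gapLeft_bounds : 3.2196475 < gapLeft ∧ gapLeft < 3.219648 := by
  obtain ⟨h1, h2⟩ := sqrt_thirty_bounds
  unfold gapLeft
  constructor <;> linarith

lemma gapRight_bounds : 3.2250016462 < gapRight ∧ gapRight < 3.2250016464 := by
  obtain ⟨h1, h2⟩ := sqrt_thirty_bounds
  unfold gapRight
  constructor <;> linarith

lemma gapLeft_eq : gapLeft = 2 + (31 * tailMax + 74) / (49 * tailMax + 117)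
    + (3 * tailMax + 7) / (5 * tailMax + 12) := by
  obtain ⟨m1, m2⟩ := tailMax_bounds
  have q := tailMax_quadratic
  have h1 : (31 * tailMax + 74) / (49 * tailMax + 117) = 54 / 85 - tailMax / 255 := by
    rw [div_eq_iff (by linarith)]
    linear_combination (7 / 255) * q
  have h2 : (3 * tailMax + 7) / (5 * tailMax + 12) = 1 - 7 / 12 * tailMax := by
    rw [div_eq_iff (by linarith)]
    linear_combination (5 / 12) * q
  rw [h1, h2, gapLeft, tailMax]
  ring

lemma Admissible.lambdaVal_le_gapLeft (h : Admissible α) {k : ℤ} (h0 : α k = 2)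
    (h1 : α (k + 1) = 1) (h2 : α (k + 2) = 1) (h3 : α (k + 3) = 1)
    (h4 : α (k - 1) = 1) (h5 : α (k - 2) = 1) (h6 : α (k - 3) = 2) :
    lambdaVal α k ≤ gapLeft := by
  have r := h.rightTail_111_le h0 h1 h2 h3
  have l := h.leftTail_112_le h4 h5 h6
  rw [lambdaVal_eq h.binary.pos, gapLeft_eq, h0]
  push_cast
  linarith

end Admissible

section Classification

variable {α : ℤ → ℕ}

lemma Admissible.lambdaVal_le_gapLeft' (h : Admissible α) {k : ℤ} (h0 : α k = 2)
    (h1 : α (k - 1) = 1) (h2 : α (k - 2) = 1) (h3 : α (k - 3) = 1)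
    (h4 : α (k + 1) = 1) (h5 : α (k + 2) = 1) (h6 : α (k + 3) = 2) :
    lambdaVal α k ≤ gapLeft := by
  have := h.reflect.lambdaVal_le_gapLeft (k := -k)
  simp only [reflect_neg_add, reflect_neg_sub, reflect_neg] at this
  rw [← neg_neg k, ← lambdaVal_reflect h.binary.pos]
  exact this h0 h1 h2 h3 h4 h5 h6

lemma IsBinary.rightTail_le_of_two (hb : IsBinary α) {k : ℤ} (h1 : α (k + 1) = 2) :
    rightTail α k ≤ 0.423 := by
  have := hb.rightTail_bounds (k + 1)
  rw [hb.rightTail_2 h1, div_le_iff₀ (by linarith)]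
  linarith

lemma IsBinary.leftTail_le_of_two (hb : IsBinary α) {k : ℤ} (h1 : α (k - 1) = 2) :
    leftTail α k ≤ 0.423 := by
  refine hb.reflect.rightTail_le_of_two ?_
  rwa [reflect_neg_add]

lemma IsBinary.lambdaVal_lt_of_one (hb : IsBinary α) {k : ℤ} (h0 : α k = 1) :
    lambdaVal α k < 2.5 := by
  have := hb.rightTail_bounds k
  have := hb.leftTail_bounds k
  rw [lambdaVal_eq hb.pos, h0]
  push_cast
  linarith

/-- Around a large value of `λ` the sequence reads `111*2111`, the centre being starred. -/
lemma Admissible.eq_of_gapLeft_lt (h : Admissible α) {k : ℤ} (hk : gapLeft < lambdaVal α k) :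
    α k = 2 ∧ (α (k + 1) = 1 ∧ α (k + 2) = 1 ∧ α (k + 3) = 1) ∧
      (α (k - 1) = 1 ∧ α (k - 2) = 1 ∧ α (k - 3) = 1) := by
  obtain ⟨g1, g2⟩ := gapLeft_bounds
  have hb := h.binary
  have r := hb.rightTail_bounds k
  have l := hb.leftTail_bounds k
  have h0 : α k = 2 := hb.eq_two fun h0 => by linarith [hb.lambdaVal_lt_of_one h0]
  have hk' := hk
  rw [lambdaVal_eq hb.pos, h0] at hk'
  push_cast at hk'
  have r1 : α (k + 1) = 1 := hb.eq_one fun h1 => by linarith [hb.rightTail_le_of_two h1]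
  have l1 : α (k - 1) = 1 := hb.eq_one fun h1 => by linarith [hb.leftTail_le_of_two h1]
  have r2 : α (k + 2) = 1 := by
    refine hb.eq_one fun r2 => ?_
    have := h.left_two (k + 2) r2 (by rwa [show k + 2 - 1 = k + 1 by ring])
      (by rwa [add_sub_cancel_right])
    rw [show k + 2 - 3 = k - 1 by ring] at this
    omega
  have l2 : α (k - 2) = 1 := by
    refine hb.eq_one fun l2 => ?_
    have := h.right_two (k - 2) l2 (by rwa [show k - 2 + 1 = k - 1 by ring])
      (by rwa [sub_add_cancel])
    rw [show k - 2 + 3 = k + 1 by ring] at this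
    omega
  obtain ⟨m1, m2⟩ := tailMax_bounds
  rcases hb (k + 3) with r3 | r3 <;> rcases hb (k - 3) with l3 | l3
  · exact ⟨h0, ⟨r1, r2, r3⟩, l1, l2, l3⟩
  · exact absurd (h.lambdaVal_le_gapLeft h0 r1 r2 r3 l1 l2 l3) (not_le.2 hk)
  · exact absurd (h.lambdaVal_le_gapLeft' h0 l1 l2 l3 r1 r2 r3) (not_le.2 hk)
  · have a := h.rightTail_112_le r1 r2 r3
    have b := h.leftTail_112_le l1 l2 l3
    have c : (3 * tailMax + 7) / (5 * tailMax + 12) ≤ 0.6 := by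
      rw [div_le_iff₀ (by linarith)]
      linarith
    linarith

end Classification

section BelowGapRight

variable {α : ℤ → ℕ}

/-- Binary sequences all of whose values `λ_k` are below the right endpoint of the gap. -/
structure IsLow (α : ℤ → ℕ) : Prop where
  binary : IsBinary α
  lt (k : ℤ) : lambdaVal α k < gapRight

namespace IsLow

lemma of_pos (hpos : ∀ n, 0 < α n) (hlt : ∀ k, lambdaVal α k < gapRight) : IsLow α := by
  refine ⟨?_, hlt⟩
  obtain ⟨g1, g2⟩ := gapRight_bounds
  have hle : ∀ n, α n ≤ 3 := by
    intro n
    by_contra! hn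
    have hn' : (4 : ℝ) ≤ α n := by exact_mod_cast hn
    have := hlt n
    rw [lambdaVal_eq hpos] at this
    linarith [rightTail_pos hpos n, rightTail_pos (reflect_pos hpos) (-n),
      rightTail_reflect_neg α n]
  have hq : ∀ β : ℤ → ℕ, (∀ n, 0 < β n) → (∀ n, β n ≤ 3) → ∀ n, 1 / 4 ≤ rightTail β n := by
    intro β hβ h3 n
    have h3' : (β (n + 1) : ℝ) ≤ 3 := by exact_mod_cast h3 (n + 1)
    have p := rightTail_pos hβ (n + 1)
    rw [rightTail_eq hβ (k := n) rfl]
    exact one_div_le_one_div_of_le (by positivity) (by linarith [rightTail_le_one hβ (n + 1)])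
  intro n
  have h3 : α n ≠ 3 := by
    intro h3
    have := hlt n
    rw [lambdaVal_eq hpos, h3] at this
    push_cast at this
    linarith [hq α hpos hle n, hq (reflect α) (reflect_pos hpos) (fun n => hle _) (-n),
      rightTail_reflect_neg α n]
  have := hle n
  have := hpos n
  omega

lemma reflect (h : IsLow α) : IsLow (reflect α) where
  binary := h.binary.reflect
  lt k := by
    rw [lambdaVal_reflect h.binary.pos]
    exact h.lt _

lemma tails_lt (h : IsLow α) {k : ℤ} (h0 : α k = 2) :
    rightTail α k + leftTail α k < 1.2250016464 := by
  have := h.lt k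
  rw [lambdaVal_eq h.binary.pos, h0] at this
  push_cast at this
  linarith [gapRight_bounds.2]

lemma right_two (h : IsLow α) (k : ℤ) (h0 : α k = 2) (h1 : α (k + 1) = 1) (h2 : α (k + 2) = 2) :
    α (k + 3) = 2 := by
  have hb := h.binary
  refine hb.eq_two fun h3 => ?_
  have a : 0.57 ≤ rightTail α (k + 2) := by
    have r := hb.rightTail_bounds (k + 2 + 1)
    rw [hb.rightTail_1 (by rwa [add_assoc]), le_div_iff₀ (by linarith)]
    linarith
  have b : 0.7 ≤ leftTail α (k + 2) := by
    have e := hb.reflect.rightTail_12 (k := -(k + 2))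
    simp only [reflect_neg_add, rightTail_reflect_neg, rightTail_reflect_neg_add,
      add_sub_cancel_right] at e
    have l := hb.leftTail_bounds k
    rw [e (by rwa [show k + 2 - 1 = k + 1 by ring]) h0, le_div_iff₀ (by linarith)]
    linarith
  linarith [h.tails_lt h2]

lemma right_one (h : IsLow α) (k : ℤ) (h0 : α k = 2) (r1 : α (k + 1) = 1) (r2 : α (k + 2) = 1)
    (r3 : α (k + 3) = 1) (l1 : α (k - 1) = 1) (l2 : α (k - 2) = 1) (l3 : α (k - 3) = 1) :
    α (k + 4) = 1 := by
  have hb := h.binary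
  refine hb.eq_one fun r4 => ?_
  have r := hb.rightTail_bounds (k + 4)
  have l := hb.leftTail_bounds (k - 3)
  have a := hb.rightTail_1112 r1 r2 r3 r4
  have b := hb.reflect.rightTail_111 (k := -k)
  simp only [reflect_neg_add, rightTail_reflect_neg, rightTail_reflect_neg_add] at b
  have a' : 0.63 ≤ rightTail α k := by
    rw [a, le_div_iff₀ (by linarith)]
    linarith
  have b' : 0.61 ≤ leftTail α k := by
    rw [b l1 l2 l3, le_div_iff₀ (by linarith)]
    linarith
  linarith [h.tails_lt h0]

lemma admissible (h : IsLow α) : Admissible α where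
  binary := h.binary
  right_two := h.right_two
  left_two k := by
    have := h.reflect.right_two (-k)
    simpa only [reflect_neg_add, reflect_neg] using this
  right_one := h.right_one
  left_one k h0 h1 h2 h3 h4 h5 h6 := by
    have := h.reflect.right_one (-k)
    simp only [reflect_neg_add, reflect_neg_sub, reflect_neg] at this
    exact this h0 h4 h5 h6 h1 h2 h3

end IsLow

/-- The sequence reads `1111*21111` around the starred position `k`. -/
def HasBlock (α : ℤ → ℕ) (k : ℤ) : Prop :=
  α k = 2 ∧ (α (k + 1) = 1 ∧ α (k + 2) = 1 ∧ α (k + 3) = 1 ∧ α (k + 4) = 1) ∧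
    (α (k - 1) = 1 ∧ α (k - 2) = 1 ∧ α (k - 3) = 1 ∧ α (k - 4) = 1)

lemma hasBlock_reflect {k : ℤ} : HasBlock (reflect α) (-k) ↔ HasBlock α k := by
  simp only [HasBlock, reflect_neg, reflect_neg_add, reflect_neg_sub]
  tauto

namespace IsLow

/-- To the right of a block the sequence continues with `211`. -/
lemma right_of_hasBlock (h : IsLow α) {k : ℤ} (hk : HasBlock α k) :
    α (k + 5) = 2 ∧ α (k + 6) = 1 ∧ α (k + 7) = 1 := by
  have hb := h.binary
  obtain ⟨h0, ⟨r1, r2, r3, r4⟩, l1, l2, l3, l4⟩ := hk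
  have l := hb.leftTail_bounds (k - 3)
  have b := hb.reflect.rightTail_111 (k := -k)
  simp only [reflect_neg_add, rightTail_reflect_neg, rightTail_reflect_neg_add] at b
  have b' : 0.612 ≤ leftTail α k := by
    rw [b l1 l2 l3, le_div_iff₀ (by linarith)]
    linarith
  have t := h.tails_lt h0
  have r5 : α (k + 5) = 2 := by
    refine hb.eq_two fun r5 => ?_
    have r := hb.rightTail_bounds (k + 5)
    have : 0.615 ≤ rightTail α k := by
      rw [hb.rightTail_11111 r1 r2 r3 r4 r5, le_div_iff₀ (by linarith)]
      linarith
    linarith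
  have r6 : α (k + 6) = 1 := by
    refine hb.eq_one fun r6 => ?_
    have p := hb.rightTail_bounds (k + 5)
    have q := hb.rightTail_bounds (k + 6)
    have e := rightTail_eq hb.pos (show k + 6 = k + 5 + 1 by ring)
    have : rightTail α (k + 5) ≤ 0.42266 := by
      rw [e, r6, Nat.cast_two, div_le_iff₀ (by linarith)]
      linarith
    have : 0.6132 ≤ rightTail α k := by
      rw [hb.rightTail_11112 r1 r2 r3 r4 r5, le_div_iff₀ (by linarith)]
      linarith
    linarith
  refine ⟨r5, r6, hb.eq_one fun r7 => ?_⟩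
  have := h.admissible.left_two (k + 7) r7 (by rwa [show k + 7 - 1 = k + 6 by ring])
    (by rwa [show k + 7 - 2 = k + 5 by ring])
  rw [show k + 7 - 3 = k + 4 by ring] at this
  omega

lemma left_of_hasBlock (h : IsLow α) {k : ℤ} (hk : HasBlock α k) :
    α (k - 5) = 2 ∧ α (k - 6) = 1 ∧ α (k - 7) = 1 := by
  have := h.reflect.right_of_hasBlock (hasBlock_reflect.2 hk)
  simpa only [reflect_neg_add] using this

/-- A block whose next `2` is followed by `111` is followed by another block. -/
lemma hasBlock_add_of_eq_one (h : IsLow α) {k : ℤ} (hk : HasBlock α k) (h8 : α (k + 8) = 1) :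
    HasBlock α (k + 5) := by
  obtain ⟨r5, r6, r7⟩ := h.right_of_hasBlock hk
  obtain ⟨h0, ⟨r1, r2, r3, r4⟩, -⟩ := hk
  have e := h.right_one (k + 5)
  simp only [HasBlock, add_assoc, add_sub_assoc] at e ⊢
  norm_num at e ⊢
  exact ⟨r5, ⟨r6, r7, h8, e r5 r6 r7 h8 r4 r3 r2⟩, r4, r3, r2, r1⟩

lemma hasBlock_sub_of_eq_one (h : IsLow α) {k : ℤ} (hk : HasBlock α k) (h8 : α (k - 8) = 1) :
    HasBlock α (k - 5) := by
  have := h.reflect.hasBlock_add_of_eq_one (hasBlock_reflect.2 hk) (by rwa [reflect_neg_add])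
  rwa [← hasBlock_reflect, show -(k - 5) = -k + 5 by ring]

lemma leftTail_of_hasBlock (h : IsLow α) {k : ℤ} (hk : HasBlock α k) :
    leftTail α k = (3 * leftTail α (k - 5) + 8) / (5 * leftTail α (k - 5) + 13) := by
  have r5 := (h.left_of_hasBlock hk).1
  obtain ⟨h0, -, l1, l2, l3, l4⟩ := hk
  have e := h.binary.reflect.rightTail_11112 (k := -k)
  simp only [reflect_neg_add, rightTail_reflect_neg, rightTail_reflect_neg_add] at e
  exact e l1 l2 l3 l4 r5

lemma rightTail_of_hasBlock (h : IsLow α) {k : ℤ} (hk : HasBlock α k) :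
    rightTail α k = (3 * rightTail α (k + 5) + 8) / (5 * rightTail α (k + 5) + 13) := by
  have r5 := (h.right_of_hasBlock hk).1
  obtain ⟨h0, ⟨l1, l2, l3, l4⟩, -⟩ := hk
  exact h.binary.rightTail_11112 l1 l2 l3 l4 r5

/-- The tail seen from a block when the sequence continues with `2` after `1111211`. -/
lemma rightTail_of_eq_two (h : IsLow α) {k : ℤ} (hk : HasBlock α k) (h8 : α (k + 8) = 2) :
    rightTail α k = (19 * rightTail α (k + 8) + 49) / (31 * rightTail α (k + 8) + 80) := by
  obtain ⟨r5, r6, r7⟩ := h.right_of_hasBlock hk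
  obtain ⟨h0, ⟨r1, r2, r3, r4⟩, -⟩ := hk
  exact h.binary.rightTail_11112112 r1 r2 r3 r4 r5 r6 r7 h8

lemma leftTail_of_eq_two (h : IsLow α) {k : ℤ} (hk : HasBlock α k) (h8 : α (k - 8) = 2) :
    leftTail α k = (19 * leftTail α (k - 8) + 49) / (31 * leftTail α (k - 8) + 80) := by
  have := h.reflect.rightTail_of_eq_two (hasBlock_reflect.2 hk) (by rwa [reflect_neg_add])
  simpa only [rightTail_reflect_neg, rightTail_reflect_neg_add] using this

end IsLow

lemma gapRight_eq : gapRight = 2 + (49 * tailMax + 117) / (80 * tailMax + 191)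
    + (787 * tailMax + 1879) / (1285 * tailMax + 3068) := by
  obtain ⟨m1, m2⟩ := tailMax_bounds
  have q := tailMax_quadratic
  have h1 : (49 * tailMax + 117) / (80 * tailMax + 191)
      = 7 / 4793 * tailMax + 2931 / 4793 := by
    rw [div_eq_iff (by linarith)]
    linear_combination (-80 / 4793) * q
  have h2 : (787 * tailMax + 1879) / (1285 * tailMax + 3068)
      = 189079 / 308723 - 7 / 1234892 * tailMax := by
    rw [div_eq_iff (by linarith)]
    linear_combination (1285 / 1234892) * q
  rw [h1, h2, gapRight, tailMax]
  ring

/-- A lower bound for `λ` at a centre of a word `2112 1111 2 1111 2 1111 2112`, where `x ≤ y` are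
the two tails that extend the word. -/
lemma gapRight_le {x y : ℝ} (hx : 1 / (2 + tailMax) ≤ x) (hxy : x ≤ y) :
    gapRight ≤ 2 + (19 * y + 49) / (31 * y + 80) + (305 * x + 787) / (498 * x + 1285) := by
  obtain ⟨m1, m2⟩ := tailMax_bounds
  set x₀ := 1 / (2 + tailMax) with hx₀
  have p : 0 < x₀ := by positivity
  have e1 : (49 * tailMax + 117) / (80 * tailMax + 191) = (19 * x₀ + 49) / (31 * x₀ + 80) := by
    rw [hx₀]
    field_simp
    ring
  have e2 : (787 * tailMax + 1879) / (1285 * tailMax + 3068)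
      = (305 * x₀ + 787) / (498 * x₀ + 1285) := by
    rw [hx₀]
    field_simp
    ring
  have hy : (19 * x + 49) / (31 * x + 80) ≤ (19 * y + 49) / (31 * y + 80) := by
    rw [div_le_div_iff₀ (by linarith) (by linarith)]
    linarith
  have d1 : (19 * x + 49) / (31 * x + 80) - (19 * x₀ + 49) / (31 * x₀ + 80)
      = (x - x₀) / ((31 * x + 80) * (31 * x₀ + 80)) := by
    have : 0 < x := by linarith
    field_simp
    ring
  have d2 : (305 * x₀ + 787) / (498 * x₀ + 1285) - (305 * x + 787) / (498 * x + 1285)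
      = (x - x₀) / ((498 * x + 1285) * (498 * x₀ + 1285)) := by
    have : 0 < x := by linarith
    field_simp
    ring
  have d : (x - x₀) / ((498 * x + 1285) * (498 * x₀ + 1285))
      ≤ (x - x₀) / ((31 * x + 80) * (31 * x₀ + 80)) := by
    have : 0 < x := by linarith
    apply div_le_div_of_nonneg_left (by linarith) (by positivity)
    apply mul_le_mul <;> linarith
  rw [gapRight_eq, e1, e2]
  linarith

namespace IsLow

/-- Blocks propagate to the right. -/
lemma hasBlock_add (h : IsLow α) {k : ℤ} (hk : HasBlock α k) : HasBlock α (k + 5) := by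
  refine h.hasBlock_add_of_eq_one hk (h.binary.eq_one fun r8 => ?_)
  have hb := h.binary
  have ha := h.admissible
  obtain ⟨m1, m2⟩ := tailMax_bounds
  have hm : 0.3693 ≤ 1 / (2 + tailMax) := by
    rw [le_div_iff₀ (by linarith)]
    linarith
  have eR := h.rightTail_of_eq_two hk r8
  have x0 := ha.le_rightTail (k + 8)
  have hR : 0.6125504 ≤ rightTail α k := by
    rw [eR, le_div_iff₀ (by linarith)]
    linarith
  have t := h.tails_lt hk.1
  rcases hb (k - 8) with l8 | l8
  swap
  · have y0 := ha.le_leftTail (k - 8)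
    have : 0.6125 ≤ leftTail α k := by
      rw [h.leftTail_of_eq_two hk l8, le_div_iff₀ (by linarith)]
      linarith
    linarith
  have hk5 := h.hasBlock_sub_of_eq_one hk l8
  have eL := h.leftTail_of_hasBlock hk
  rcases hb (k - 5 - 8) with l13 | l13
  · have hk10 := h.hasBlock_sub_of_eq_one hk5 l13
    have z := hb.leftTail_bounds (k - 5 - 5 - 5)
    have w : 0.61199 ≤ leftTail α (k - 5 - 5) := by
      rw [h.leftTail_of_hasBlock hk10, le_div_iff₀ (by linarith)]
      linarith
    have v : leftTail α (k - 5) ≤ 0.612455 := by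
      rw [h.leftTail_of_hasBlock hk5, div_le_iff₀ (by linarith)]
      linarith
    have v' := hb.leftTail_bounds (k - 5)
    have : 0.6124514 ≤ leftTail α k := by
      rw [eL, le_div_iff₀ (by linarith)]
      linarith
    linarith
  · have eL5 := h.leftTail_of_eq_two hk5 l13
    have eR5 := h.rightTail_of_hasBlock hk5
    rw [sub_add_cancel, eR] at eR5
    rw [eL5] at eL
    have y0 := ha.le_leftTail (k - 5 - 8)
    have lt0 := h.lt k
    have lt5 := h.lt (k - 5)
    rw [lambdaVal_eq hb.pos, hk.1, eL, eR] at lt0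
    rw [lambdaVal_eq hb.pos, hk5.1, eL5, eR5] at lt5
    generalize rightTail α (k + 8) = x at *
    generalize leftTail α (k - 5 - 8) = y at *
    have comp : ∀ z : ℝ, 0 < z → (3 * ((19 * z + 49) / (31 * z + 80)) + 8)
        / (5 * ((19 * z + 49) / (31 * z + 80)) + 13) = (305 * z + 787) / (498 * z + 1285) := by
      intro z hz
      field_simp
      ring
    rw [comp _ (by linarith)] at lt0 lt5
    push_cast at lt0 lt5
    rcases le_total x y with hxy | hxy
    · linarith [gapRight_le x0 hxy]
    · linarith [gapRight_le y0 hxy]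

lemma hasBlock_sub (h : IsLow α) {k : ℤ} (hk : HasBlock α k) : HasBlock α (k - 5) := by
  have := h.reflect.hasBlock_add (hasBlock_reflect.2 hk)
  rwa [← hasBlock_reflect, show -(k - 5) = -k + 5 by ring]

lemma hasBlock_of_gapLeft_lt (h : IsLow α) {k : ℤ} (hk : gapLeft < lambdaVal α k) :
    HasBlock α k := by
  obtain ⟨h0, ⟨r1, r2, r3⟩, l1, l2, l3⟩ := h.admissible.eq_of_gapLeft_lt hk
  exact ⟨h0, ⟨r1, r2, r3, h.right_one k h0 r1 r2 r3 l1 l2 l3⟩, l1, l2, l3,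
    h.admissible.left_one k h0 r1 r2 r3 l1 l2 l3⟩

end IsLow

end BelowGapRight

section Periodic

variable {α : ℤ → ℕ}

lemma rightTail_eq_of_period_five (hb : IsBinary α) (hp : ∀ n, α (n + 5) = α n) {k : ℤ}
    (hk : HasBlock α k) : rightTail α k = Real.sqrt 65 / 5 - 1 := by
  obtain ⟨h0, ⟨r1, r2, r3, r4⟩, -⟩ := hk
  have e := hb.rightTail_11112 r1 r2 r3 r4 (by rw [hp, h0])
  have p := rightTail_pos hb.pos k
  rw [rightTail_periodic fun n _ => hp n, eq_div_iff (by linarith)] at e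
  have : Real.sqrt 65 = 5 * (rightTail α k + 1) := by
    rw [Real.sqrt_eq_iff_mul_self_eq (by norm_num) (by linarith)]
    linear_combination -5 * e
  linarith

lemma lambdaVal_eq_of_period_five (hb : IsBinary α) (hp : ∀ n, α (n + 5) = α n) {k : ℤ}
    (hk : HasBlock α k) : lambdaVal α k = 2 * Real.sqrt 65 / 5 := by
  have r := rightTail_eq_of_period_five hb hp hk
  have l : leftTail α k = Real.sqrt 65 / 5 - 1 := by
    refine rightTail_eq_of_period_five hb.reflect (fun n => ?_) (hasBlock_reflect.2 hk)
    rw [reflect, reflect, ← hp]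
    congr 1
    ring
  rw [lambdaVal_eq hb.pos, r, l, hk.1]
  push_cast
  ring

lemma sqrt_sixtyFive_bounds : 8.0622 < Real.sqrt 65 ∧ Real.sqrt 65 < 8.0623 :=
  ⟨Real.lt_sqrt_of_sq_lt (by norm_num), (Real.sqrt_lt' (by norm_num)).2 (by norm_num)⟩

/-- A sequence attaining its largest value of `λ` has that value as its Markov value. -/
lemma markovValue_eq {x : ℝ} {k : ℤ} (hk : lambdaVal α k = x) (hle : ∀ n, lambdaVal α n ≤ x) :
    BddAbove (range (lambdaVal α)) ∧ markovValue α = x := by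
  have hB : BddAbove (range (lambdaVal α)) := ⟨x, by rintro _ ⟨n, rfl⟩; exact hle n⟩
  exact ⟨hB, le_antisymm (ciSup_le hle) (hk ▸ le_ciSup hB k)⟩

lemma markovValue_of_blocks {k : ℤ} (hk : ∀ j : ℤ, HasBlock α (k + 5 * j)) :
    IsBinary α ∧ BddAbove (range (lambdaVal α)) ∧ markovValue α = 2 * Real.sqrt 65 / 5 := by
  have val : ∀ n, α n = if (n - k) % 5 = 0 then 2 else 1 := by
    intro n
    obtain ⟨h0, ⟨h1, h2, h3, h4⟩, -⟩ := hk ((n - k) / 5)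
    have hi : (n - k) % 5 = 0 ∨ (n - k) % 5 = 1 ∨ (n - k) % 5 = 2 ∨ (n - k) % 5 = 3 ∨
        (n - k) % 5 = 4 := by omega
    have hn : n = k + 5 * ((n - k) / 5) + (n - k) % 5 := by omega
    rcases hi with hi | hi | hi | hi | hi <;> rw [hi] at hn ⊢
    · rw [hn]; simpa using h0
    · rw [hn]; simpa using h1
    · rw [hn]; simpa using h2
    · rw [hn]; simpa using h3
    · rw [hn]; simpa using h4
  have hb : IsBinary α := by
    intro n
    rw [val]
    split_ifs <;> simp
  have hp : ∀ n, α (n + 5) = α n := by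
    intro n
    rw [val, val, show n + 5 - k = n - k + 5 by ring, Int.add_emod_right]
  refine ⟨hb, markovValue_eq (lambdaVal_eq_of_period_five hb hp (hk 0)) fun n => ?_⟩
  rcases hb n with h | h
  · linarith [hb.lambdaVal_lt_of_one h, sqrt_sixtyFive_bounds.1]
  · have hn : (n - k) % 5 = 0 := by
      by_contra hn
      simp [val, hn] at h
    have := hk ((n - k) / 5)
    rw [show k + 5 * ((n - k) / 5) = n by omega] at this
    exact (lambdaVal_eq_of_period_five hb hp this).le

lemma IsLow.markovValue_eq_of_hasBlock (h : IsLow α) {k : ℤ} (hk : HasBlock α k) :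
    markovValue α = 2 * Real.sqrt 65 / 5 := by
  refine (markovValue_of_blocks (k := k) fun j => ?_).2.2
  induction j using Int.induction_on with
  | zero => simpa using hk
  | succ i ih => simpa [mul_add, add_assoc] using h.hasBlock_add ih
  | pred i ih => simpa [mul_sub, add_sub_assoc] using h.hasBlock_sub ih

/-- The periodic sequence `...2111121111...`. -/
def isolatedSeq (n : ℤ) : ℕ := if n % 5 = 0 then 2 else 1

lemma isolated_mem : 2 * Real.sqrt 65 / 5 ∈ markovSpectrum := by
  have h : ∀ j : ℤ, HasBlock isolatedSeq (0 + 5 * j) := by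
    intro j
    unfold HasBlock isolatedSeq
    refine ⟨if_pos (by omega), ⟨?_, ?_, ?_, ?_⟩, ?_, ?_, ?_, ?_⟩ <;> exact if_neg (by omega)
  obtain ⟨hb, hB, hm⟩ := markovValue_of_blocks h
  exact ⟨isolatedSeq, hb.pos, hB, hm⟩

end Periodic

section Endpoints

variable {α : ℤ → ℕ}

lemma rightTail_eq_tailMax (hb : IsBinary α) {k : ℤ} (hp : ∀ n, k < n → α (n + 4) = α n)
    (h1 : α (k + 1) = 1) (h2 : α (k + 2) = 2) (h3 : α (k + 3) = 2) (h4 : α (k + 4) = 2) :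
    rightTail α k = tailMax := by
  have e := rightTail_1222 hb h1 h2 h3 h4
  have p := rightTail_pos hb.pos k
  have m := tailMax_bounds.1
  have q := tailMax_quadratic
  rw [rightTail_periodic hp, eq_div_iff (by linarith)] at e
  have : (rightTail α k - tailMax) * (7 * (rightTail α k + tailMax) + 12) = 0 := by
    linear_combination e - q
  rcases mul_eq_zero.1 this with h | h <;> linarith

lemma leftTail_eq_tailMax (hb : IsBinary α) {k : ℤ} (hp : ∀ n, n < k → α (n - 4) = α n)
    (h1 : α (k - 1) = 1) (h2 : α (k - 2) = 2) (h3 : α (k - 3) = 2) (h4 : α (k - 4) = 2) :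
    leftTail α k = tailMax := by
  refine rightTail_eq_tailMax hb.reflect (fun n hn => ?_) ?_ ?_ ?_ ?_
  · rw [reflect, reflect, neg_add', hp (-n) (by omega)]
  all_goals rwa [reflect_neg_add]

/-- The sequence `...2221 22112 111 21122 1222...` attaining the left endpoint. -/
def leftSeq (n : ℤ) : ℕ :=
  if n ≤ -3 then (if n % 4 = 3 then 1 else 2)
  else if n ≤ 6 then (if n % 4 = 0 then 2 else 1)
  else (if n % 4 = 1 then 1 else 2)

lemma leftSeq_eq_one_iff (n : ℤ) : leftSeq n = 1 ↔
    n ≤ -3 ∧ n % 4 = 3 ∨ (-3 < n ∧ n ≤ 6) ∧ n % 4 ≠ 0 ∨ 6 < n ∧ n % 4 = 1 := by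
  unfold leftSeq
  split_ifs <;> omega

lemma leftSeq_eq_two_iff (n : ℤ) : leftSeq n = 2 ↔
    n ≤ -3 ∧ n % 4 ≠ 3 ∨ (-3 < n ∧ n ≤ 6) ∧ n % 4 = 0 ∨ 6 < n ∧ n % 4 ≠ 1 := by
  unfold leftSeq
  split_ifs <;> omega

lemma leftSeq_admissible : Admissible leftSeq where
  binary n := by rw [leftSeq_eq_one_iff, leftSeq_eq_two_iff]; omega
  right_two n := by simp only [leftSeq_eq_one_iff, leftSeq_eq_two_iff]; omega
  left_two n := by simp only [leftSeq_eq_one_iff, leftSeq_eq_two_iff]; omega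
  right_one n := by simp only [leftSeq_eq_one_iff, leftSeq_eq_two_iff]; omega
  left_one n := by simp only [leftSeq_eq_one_iff, leftSeq_eq_two_iff]; omega

lemma lambdaVal_leftSeq : lambdaVal leftSeq 0 = gapLeft := by
  have hb := leftSeq_admissible.binary
  obtain ⟨m, -⟩ := tailMax_bounds
  have r8 : rightTail leftSeq 8 = tailMax := by
    refine rightTail_eq_tailMax hb (fun n hn => ?_) rfl rfl rfl rfl
    unfold leftSeq
    split_ifs <;> omega
  have r0 := hb.rightTail_1112 (k := 0) rfl rfl rfl rfl
  have r4 := hb.rightTail_112 (k := 4) rfl rfl rfl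
  have r7 := hb.rightTail_2 (k := 7) rfl
  have l4 : leftTail leftSeq (-4) = tailMax := by
    refine leftTail_eq_tailMax hb (fun n hn => ?_) rfl rfl rfl rfl
    unfold leftSeq
    split_ifs <;> omega
  have l0 := hb.reflect.rightTail_112 (k := -0) rfl rfl rfl
  have l3 := leftTail_eq hb.pos (show (-4 : ℤ) = -3 - 1 by norm_num)
  simp only [rightTail_reflect_neg, rightTail_reflect_neg_add] at l0
  norm_num at r0 r4 r7 l0 l3
  rw [lambdaVal_eq hb.pos, r0, r4, r7, r8, l0, l3, l4, gapLeft_eq,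
    show leftSeq 0 = 2 from rfl, show leftSeq (-4) = 2 from rfl]
  push_cast
  congr 1
  · congr 1
    field_simp
    ring
  · field_simp
    ring

lemma gapLeft_mem : gapLeft ∈ markovSpectrum := by
  refine ⟨leftSeq, leftSeq_admissible.binary.pos, markovValue_eq lambdaVal_leftSeq fun n => ?_⟩
  by_contra! hn
  have := leftSeq_admissible.eq_of_gapLeft_lt hn
  simp only [leftSeq_eq_one_iff, leftSeq_eq_two_iff] at this
  omega

/-- The sequence `...2221 22112 1111 2 1111 2 1111 21122 1222...` attaining the right
endpoint. -/
def rightSeq (n : ℤ) : ℕ :=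
  if n ≤ -3 then (if n % 4 = 3 then 1 else 2)
  else if n ≤ 17 then (if n % 5 = 0 then 2 else 1)
  else (if n % 4 = 0 then 1 else 2)

lemma rightSeq_eq_one_iff (n : ℤ) : rightSeq n = 1 ↔
    n ≤ -3 ∧ n % 4 = 3 ∨ (-3 < n ∧ n ≤ 17) ∧ n % 5 ≠ 0 ∨ 17 < n ∧ n % 4 = 0 := by
  unfold rightSeq
  split_ifs <;> omega

lemma rightSeq_eq_two_iff (n : ℤ) : rightSeq n = 2 ↔
    n ≤ -3 ∧ n % 4 ≠ 3 ∨ (-3 < n ∧ n ≤ 17) ∧ n % 5 = 0 ∨ 17 < n ∧ n % 4 ≠ 0 := by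
  unfold rightSeq
  split_ifs <;> omega

lemma rightSeq_admissible : Admissible rightSeq where
  binary n := by rw [rightSeq_eq_one_iff, rightSeq_eq_two_iff]; omega
  right_two n := by simp only [rightSeq_eq_one_iff, rightSeq_eq_two_iff]; omega
  left_two n := by simp only [rightSeq_eq_one_iff, rightSeq_eq_two_iff]; omega
  right_one n := by simp only [rightSeq_eq_one_iff, rightSeq_eq_two_iff]; omega
  left_one n := by simp only [rightSeq_eq_one_iff, rightSeq_eq_two_iff]; omega

lemma lambdaVal_rightSeq : lambdaVal rightSeq 5 = gapRight ∧ lambdaVal rightSeq 10 = gapRight := by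
  have hb := rightSeq_admissible.binary
  obtain ⟨m, -⟩ := tailMax_bounds
  have r19 : rightTail rightSeq 19 = tailMax := by
    refine rightTail_eq_tailMax hb (fun n hn => ?_) rfl rfl rfl rfl
    unfold rightSeq
    split_ifs <;> omega
  have l4 : leftTail rightSeq (-4) = tailMax := by
    refine leftTail_eq_tailMax hb (fun n hn => ?_) rfl rfl rfl rfl
    unfold rightSeq
    split_ifs <;> omega
  have r18 := hb.rightTail_2 (k := 18) rfl
  have r10 := hb.rightTail_11112112 (k := 10) rfl rfl rfl rfl rfl rfl rfl rfl
  have r5 := hb.rightTail_11112 (k := 5) rfl rfl rfl rfl rfl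
  have l3 := leftTail_eq hb.pos (show (-4 : ℤ) = -3 - 1 by norm_num)
  have l5 := hb.reflect.rightTail_11112112 (k := -5) rfl rfl rfl rfl rfl rfl rfl rfl
  have l10 := hb.reflect.rightTail_11112 (k := -10) rfl rfl rfl rfl rfl
  simp only [rightTail_reflect_neg, rightTail_reflect_neg_add] at l5 l10
  norm_num at r18 r10 r5 l3 l5 l10
  rw [show rightSeq (-4) = 2 from rfl, l4, Nat.cast_two] at l3
  rw [r19] at r18
  have f : (19 * (1 / (2 + tailMax)) + 49) / (31 * (1 / (2 + tailMax)) + 80)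
      = (49 * tailMax + 117) / (80 * tailMax + 191) := by
    field_simp
    ring
  have g : (3 * ((49 * tailMax + 117) / (80 * tailMax + 191)) + 8)
      / (5 * ((49 * tailMax + 117) / (80 * tailMax + 191)) + 13)
      = (787 * tailMax + 1879) / (1285 * tailMax + 3068) := by
    field_simp
    ring
  rw [← one_div] at r18 l3
  rw [r18, f] at r10
  rw [l3, f] at l5
  rw [r10, g] at r5
  rw [l5, g] at l10
  rw [lambdaVal_eq hb.pos, lambdaVal_eq hb.pos, r5, r10, l5, l10, gapRight_eq,
    show rightSeq 5 = 2 from rfl, show rightSeq 10 = 2 from rfl]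
  push_cast
  constructor <;> ring

lemma gapRight_mem : gapRight ∈ markovSpectrum := by
  obtain ⟨v5, v10⟩ := lambdaVal_rightSeq
  refine ⟨rightSeq, rightSeq_admissible.binary.pos, markovValue_eq v5 fun n => ?_⟩
  by_contra! hn
  have := rightSeq_admissible.eq_of_gapLeft_lt
    (hn.trans' (gapLeft_bounds.2.trans (gapRight_bounds.1.trans' (by norm_num))))
  have : n = 5 ∨ n = 10 := by
    simp only [rightSeq_eq_one_iff, rightSeq_eq_two_iff] at this
    omega
  rcases this with rfl | rfl <;> linarith

end Endpoints

/-- The intersection of the Markov spectrum with the open interval consists of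
exactly one (hence isolated) point, and both endpoints belong to the Markov
spectrum. -/
theorem markov_gap_13 :
    markovSpectrum ∩ Ioo ((14775 - 599 * Real.sqrt 30) / 3570) ((9537392579 + 1230099 * Real.sqrt 30) / 2959418678) = {(2 * Real.sqrt 65 / 5 : ℝ)} ∧
    ((14775 - 599 * Real.sqrt 30) / 3570) ∈ markovSpectrum ∧ ((9537392579 + 1230099 * Real.sqrt 30) / 2959418678) ∈ markovSpectrum := by
  refine ⟨Subset.antisymm ?_ ?_, gapLeft_mem, gapRight_mem⟩
  · rintro x ⟨⟨α, hpos, hB, rfl⟩, hl, hu⟩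
    have low : IsLow α := IsLow.of_pos hpos fun k => (le_ciSup hB k).trans_lt hu
    obtain ⟨k, hk⟩ := exists_lt_of_lt_ciSup hl
    exact low.markovValue_eq_of_hasBlock (low.hasBlock_of_gapLeft_lt hk)
  · rintro x rfl
    obtain ⟨h1, h2⟩ := sqrt_sixtyFive_bounds
    refine ⟨isolated_mem, gapLeft_bounds.2.trans ?_, gapRight_bounds.1.trans' ?_⟩ <;> linarith
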